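/- Let I and J be ℝ-linear endomorphisms of E such that I ∘ J = −J ∘ I and the concomitant C_b(I,J) vanishes identically. Then for all X, Y ∈ E: T_{b_I} J(X,Y) = −T_b J(I X, Y) − T_b J(X, I Y) − I(T_b J(X,Y)), where T_{b_I} denotes the Nijenhuis torsion taken with respect to the deformed bracket b_I. -/

import Mathlib

variable {E : Type*} [AddCommGroup E] [Module ℝ E]

/-- The deformed bracket `b_I(X,Y) = b(I X, Y) + b(X, I Y) - I (b(X,Y))`. -/
noncomputable def deform (b : E →ₗ[ℝ] E →ₗ[ℝ] E) (I : E →ₗ[ℝ] E) :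
    E →ₗ[ℝ] E →ₗ[ℝ] E :=
  b ∘ₗ I + LinearMap.compl₂ b I - LinearMap.compr₂ b I

/-- The Nijenhuis torsion of `I` with respect to `b`:
`T_b I (X,Y) = b(I X, I Y) - I (b_I(X,Y))`. -/
noncomputable def torsion (b : E →ₗ[ℝ] E →ₗ[ℝ] E) (I : E →ₗ[ℝ] E) (X Y : E) : E :=
  b (I X) (I Y) - I (deform b I X Y)

/-- The concomitant `C_b(I,J)(X,Y) = b_{I,J}(X,Y) + b_{J,I}(X,Y)`. -/
noncomputable def concomitant (b : E →ₗ[ℝ] E →ₗ[ℝ] E) (I J : E →ₗ[ℝ] E) (X Y : E) : E :=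
  deform (deform b I) J X Y + deform (deform b J) I X Y

@[simp]
theorem deform_apply (b : E →ₗ[ℝ] E →ₗ[ℝ] E) (I : E →ₗ[ℝ] E) (X Y : E) :
    deform b I X Y = b (I X) Y + b X (I Y) - I (b X Y) := rfl

theorem statement19 (b : E →ₗ[ℝ] E →ₗ[ℝ] E) (I J : E →ₗ[ℝ] E)
    (hanti : I ∘ₗ J = -(J ∘ₗ I))
    (hC : ∀ X Y : E, concomitant b I J X Y = 0) :
    ∀ X Y : E,
      torsion (deform b I) J X Y =
        -torsion b J (I X) Y - torsion b J X (I Y) - I (torsion b J X Y) := by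
  intro X Y
  have hIJ (Z : E) : I (J Z) = -J (I Z) := LinearMap.congr_fun hanti Z
  have hJC := congrArg J (hC X Y)
  simp only [concomitant, torsion, deform_apply, hIJ, map_add, map_sub, map_neg, map_zero,
    LinearMap.neg_apply] at hJC ⊢
  linear_combination (norm := module) -hJC
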